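/- The number of isomorphism classes of finite connected simple graphs with no isolated vertices having exactly 6 edges is 30. -/

import Mathlib

/-- A graphlet with `k` edges: a finite connected simple graph with no isolated
vertices whose edge set has cardinality `k` (vertex set taken as `Fin n` for some `n`). -/
def Graphlet (k : ℕ) :=
  { G : Σ n : ℕ, SimpleGraph (Fin n) //
      G.2.Connected ∧ (∀ v, ∃ w, G.2.Adj v w) ∧ G.2.edgeSet.ncard = k }

/-- Two graphlets are related iff they are isomorphic as simple graphs. -/
def graphletIso {k : ℕ} (G H : Graphlet k) : Prop :=
  Nonempty (G.1.2 ≃g H.1.2)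

open SimpleGraph

/-- A vertex count together with a list of edges between the vertices `0, 1, …`. -/
abbrev EdgeList := ℕ × List (ℕ × ℕ)

namespace EdgeList

/-- The simple graph on `Fin r.1` described by an edge list. -/
def graph (r : EdgeList) : SimpleGraph (Fin r.1) :=
  SimpleGraph.fromRel fun u v => ((u : ℕ), (v : ℕ)) ∈ r.2

instance (r : EdgeList) : DecidableRel r.graph.Adj :=
  inferInstanceAs (DecidableRel (SimpleGraph.fromRel _).Adj)

/-- Every edge points upwards and every vertex other than `0` is the upper end of an edge,
so that the vertices are listed in the order of a growing connected graph. -/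
def IsGrowing (r : EdgeList) : Prop :=
  0 < r.1 ∧ (∀ e ∈ r.2, e.1 < e.2 ∧ e.2 < r.1) ∧ ∀ v < r.1, v ≠ 0 → ∃ e ∈ r.2, e.2 = v

instance (r : EdgeList) : Decidable r.IsGrowing := by
  unfold IsGrowing; infer_instance

/-- Backtracking search: can the partial map `i ↦ p[i]` be prolonged by `m` further vertices to an
injection from the vertices of `r` to those of `s` which maps edges to edges? -/
def canProlong (r s : EdgeList) : ℕ → List ℕ → Bool
  | 0, _ => true
  | m + 1, p => (List.range s.1).any fun x =>
      !p.contains x &&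
      r.2.all (fun e => e.2 != p.length ||
        (s.2.contains (p.getD e.1 0, x) || s.2.contains (x, p.getD e.1 0))) &&
      canProlong r s m (p ++ [x])

/-- The degree of a vertex in an edge list. -/
def valency (r : EdgeList) (v : ℕ) : ℕ :=
  r.2.countP fun e => e.1 == v || e.2 == v

/-- A number which rules out most pairs of non-isomorphic edge lists quickly. -/
def signature (r : EdgeList) : ℕ :=
  (r.2.map fun e => (r.valency e.1 * r.valency e.2 + 1) ^ 2 + r.valency e.1 ^ 3 +
    r.valency e.2 ^ 3).sum

/-- Adding an edge between two vertices of `r`. -/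
abbrev addEdge (r : EdgeList) (i j : ℕ) : EdgeList := (r.1, (i, j) :: r.2)

/-- Adding a new vertex to `r`, joined to the vertex `i` only. -/
abbrev addLeaf (r : EdgeList) (i : ℕ) : EdgeList := (r.1 + 1, (i, r.1) :: r.2)

/-- Representatives of the connected graphs with `k ≤ 6` edges. -/
def representatives : ℕ → List EdgeList
  | 0 => [(1, [])]
  | 1 => [(2, [(0, 1)])]
  | 2 => [(3, [(0, 1), (0, 2)])]
  | 3 => [(3, [(0, 1), (0, 2), (1, 2)]),
    (4, [(0, 1), (0, 2), (0, 3)]),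
    (4, [(0, 1), (0, 2), (1, 3)])]
  | 4 => [(4, [(0, 1), (0, 2), (0, 3), (1, 2)]),
    (4, [(0, 1), (0, 2), (1, 3), (2, 3)]),
    (5, [(0, 1), (0, 2), (0, 3), (0, 4)]),
    (5, [(0, 1), (0, 2), (0, 3), (1, 4)]),
    (5, [(0, 1), (0, 2), (1, 3), (2, 4)])]
  | 5 => [(4, [(0, 1), (0, 2), (0, 3), (1, 2), (1, 3)]),
    (5, [(0, 1), (0, 2), (0, 3), (0, 4), (1, 2)]),
    (5, [(0, 1), (0, 2), (0, 3), (1, 2), (1, 4)]),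
    (5, [(0, 1), (0, 2), (0, 3), (1, 2), (3, 4)]),
    (5, [(0, 1), (0, 2), (0, 3), (1, 4), (2, 4)]),
    (5, [(0, 1), (0, 2), (1, 3), (2, 4), (3, 4)]),
    (6, [(0, 1), (0, 2), (0, 3), (0, 4), (0, 5)]),
    (6, [(0, 1), (0, 2), (0, 3), (0, 4), (1, 5)]),
    (6, [(0, 1), (0, 2), (0, 3), (1, 4), (1, 5)]),
    (6, [(0, 1), (0, 2), (0, 3), (1, 4), (2, 5)]),
    (6, [(0, 1), (0, 2), (0, 3), (1, 4), (4, 5)]),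
    (6, [(0, 1), (0, 2), (1, 3), (2, 4), (3, 5)])]
  | 6 => [(4, [(0, 1), (0, 2), (0, 3), (1, 2), (1, 3), (2, 3)]),
    (5, [(0, 1), (0, 2), (0, 3), (0, 4), (1, 2), (1, 3)]),
    (5, [(0, 1), (0, 2), (0, 3), (0, 4), (1, 2), (3, 4)]),
    (5, [(0, 1), (0, 2), (0, 3), (1, 2), (1, 3), (2, 4)]),
    (5, [(0, 1), (0, 2), (0, 3), (1, 2), (1, 4), (3, 4)]),
    (5, [(0, 1), (0, 2), (0, 3), (1, 4), (2, 4), (3, 4)]),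
    (6, [(0, 1), (0, 2), (0, 3), (0, 4), (0, 5), (1, 2)]),
    (6, [(0, 1), (0, 2), (0, 3), (0, 4), (1, 2), (1, 5)]),
    (6, [(0, 1), (0, 2), (0, 3), (0, 4), (1, 2), (3, 5)]),
    (6, [(0, 1), (0, 2), (0, 3), (0, 4), (1, 5), (2, 5)]),
    (6, [(0, 1), (0, 2), (0, 3), (1, 2), (1, 4), (2, 5)]),
    (6, [(0, 1), (0, 2), (0, 3), (1, 2), (1, 4), (3, 5)]),
    (6, [(0, 1), (0, 2), (0, 3), (1, 2), (3, 4), (3, 5)]),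
    (6, [(0, 1), (0, 2), (0, 3), (1, 2), (3, 4), (4, 5)]),
    (6, [(0, 1), (0, 2), (0, 3), (1, 4), (1, 5), (2, 4)]),
    (6, [(0, 1), (0, 2), (0, 3), (1, 4), (2, 4), (3, 5)]),
    (6, [(0, 1), (0, 2), (0, 3), (1, 4), (2, 4), (4, 5)]),
    (6, [(0, 1), (0, 2), (0, 3), (1, 4), (2, 5), (4, 5)]),
    (6, [(0, 1), (0, 2), (1, 3), (2, 4), (3, 5), (4, 5)]),
    (7, [(0, 1), (0, 2), (0, 3), (0, 4), (0, 5), (0, 6)]),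
    (7, [(0, 1), (0, 2), (0, 3), (0, 4), (0, 5), (1, 6)]),
    (7, [(0, 1), (0, 2), (0, 3), (0, 4), (1, 5), (1, 6)]),
    (7, [(0, 1), (0, 2), (0, 3), (0, 4), (1, 5), (2, 6)]),
    (7, [(0, 1), (0, 2), (0, 3), (0, 4), (1, 5), (5, 6)]),
    (7, [(0, 1), (0, 2), (0, 3), (1, 4), (1, 5), (2, 6)]),
    (7, [(0, 1), (0, 2), (0, 3), (1, 4), (2, 5), (3, 6)]),
    (7, [(0, 1), (0, 2), (0, 3), (1, 4), (2, 5), (4, 6)]),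
    (7, [(0, 1), (0, 2), (0, 3), (1, 4), (4, 5), (4, 6)]),
    (7, [(0, 1), (0, 2), (0, 3), (1, 4), (4, 5), (5, 6)]),
    (7, [(0, 1), (0, 2), (1, 3), (2, 4), (3, 5), (4, 6)])]
  | _ => []

theorem isGrowing_of_mem_representatives :
    ∀ k < 7, ∀ r ∈ representatives k, r.IsGrowing := by
  decide +kernel

theorem sum_degree_of_mem_representatives :
    ∀ k < 7, ∀ r ∈ representatives k, ∑ v, r.graph.degree v = 2 * k := by
  decide +kernel

theorem canProlong_addEdge :
    ∀ k < 6, ∀ r ∈ representatives k, ∀ j < r.1, ∀ i < j, (i, j) ∈ r.2 ∨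
      ∃ s ∈ representatives (k + 1), s.signature = (r.addEdge i j).signature ∧
        canProlong s (r.addEdge i j) s.1 [] = true := by
  decide +kernel

theorem canProlong_addLeaf :
    ∀ k < 6, ∀ r ∈ representatives k, ∀ i < r.1,
      ∃ s ∈ representatives (k + 1), s.signature = (r.addLeaf i).signature ∧
        canProlong s (r.addLeaf i) s.1 [] = true := by
  decide +kernel

end EdgeList

namespace SimpleGraph

/-- An isomorphism invariant built from the degrees at distance at most `2`. -/
def degreeInvariant {V : Type*} [Fintype V] (G : SimpleGraph V) [DecidableRel G.Adj] : ℕ :=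
  ∑ v, G.degree v * (∑ w, if G.Adj v w then G.degree w ^ 2 else 0) ^ 2

theorem Iso.degreeInvariant_eq {V W : Type*} [Fintype V] [Fintype W] {G : SimpleGraph V}
    {H : SimpleGraph W} [DecidableRel G.Adj] [DecidableRel H.Adj] (e : G ≃g H) :
    G.degreeInvariant = H.degreeInvariant := by
  unfold degreeInvariant
  refine Fintype.sum_equiv e.toEquiv _ _ fun v => ?_
  have hsum : (∑ w, if G.Adj v w then G.degree w ^ 2 else 0) =
      ∑ w, if H.Adj (e v) w then H.degree w ^ 2 else 0 :=
    Fintype.sum_equiv e.toEquiv _ _ fun w => by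
      simp [e.map_adj_iff, e.degree_eq]
  rw [hsum]
  simp [e.degree_eq]

end SimpleGraph

namespace EdgeList

theorem nodup_degreeInvariant :
    ((representatives 6).map fun r => r.graph.degreeInvariant).Nodup := by
  decide +kernel
end EdgeList

namespace SimpleGraph

variable {V W : Type*} {G : SimpleGraph V} {H : SimpleGraph W}

/-- A copy of a nonempty graph in a connected graph which uses every edge at its vertices is an
isomorphism. -/
theorem Copy.nonempty_iso_of_closed [Nonempty W] (f : Copy H G) (hG : G.Connected)
    (h : ∀ u v, G.Adj (f u) v → ∃ w, f w = v ∧ H.Adj u w) : Nonempty (H ≃g G) := by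
  have hsurj : Function.Surjective f := by
    intro v
    obtain ⟨u⟩ := ‹Nonempty W›
    obtain ⟨p⟩ := hG.preconnected (f u) v
    generalize ha : f u = a at p
    induction p generalizing u with
    | nil => exact ⟨u, ha⟩
    | cons hadj _ ih =>
      subst ha
      obtain ⟨w, hw, -⟩ := h u _ hadj
      exact ih w hw
  refine ⟨⟨Equiv.ofBijective f ⟨f.injective, hsurj⟩, fun {u v} => ?_⟩⟩
  refine ⟨fun hadj => ?_, fun hadj => f.toHom.map_adj hadj⟩
  obtain ⟨w, hw, huw⟩ := h u (f v) hadj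
  rwa [← f.injective hw]

/-- A copy of a graph in a finite connected graph with the same number of edges is an
isomorphism. -/
theorem Copy.nonempty_iso_of_ncard_le [Nonempty W] [Finite V] (f : Copy H G)
    (hG : G.Connected) (hcard : G.edgeSet.ncard ≤ H.edgeSet.ncard) : Nonempty (H ≃g G) := by
  have hinj : Function.Injective (Sym2.map f) := Sym2.map.injective f.injective
  have hsub : Sym2.map f '' H.edgeSet ⊆ G.edgeSet := by
    rintro _ ⟨e, he, rfl⟩
    exact f.toHom.map_mem_edgeSet he
  have heq : Sym2.map f '' H.edgeSet = G.edgeSet :=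
    Set.eq_of_subset_of_ncard_le hsub
      (by rwa [Set.ncard_image_of_injective _ hinj]) (Set.toFinite _)
  refine f.nonempty_iso_of_closed hG fun u v hadj => ?_
  have hmem : s(f u, v) ∈ Sym2.map f '' H.edgeSet := heq ▸ hadj
  obtain ⟨e, he, hev⟩ := hmem
  induction e with | _ a b
  rw [Sym2.map_mk, Sym2.eq_iff] at hev
  obtain ⟨ha, hb⟩ | ⟨ha, hb⟩ := hev
  · exact ⟨b, hb, f.injective ha ▸ he⟩
  · exact ⟨a, ha, f.injective hb ▸ (H.adj_symm he)⟩

/-- A copy of a graph with fewer edges in a finite connected graph misses an edge at one of its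
vertices. -/
theorem Copy.exists_adj_of_ncard_lt [Nonempty W] [Finite V] (f : Copy H G)
    (hG : G.Connected) (hcard : H.edgeSet.ncard < G.edgeSet.ncard) :
    ∃ u v, G.Adj (f u) v ∧ ∀ w, f w = v → ¬ H.Adj u w := by
  by_contra! h
  obtain ⟨e⟩ := f.nonempty_iso_of_closed hG h
  exact hcard.ne (Nat.card_congr e.mapEdgeSet)

end SimpleGraph

namespace EdgeList

theorem graph_adj {r : EdgeList} {u v : Fin r.1} :
    r.graph.Adj u v ↔ u ≠ v ∧ (((u : ℕ), (v : ℕ)) ∈ r.2 ∨ ((v : ℕ), (u : ℕ)) ∈ r.2) :=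
  Iff.rfl

theorem exists_prolongation {r s : EdgeList} (hr : ∀ e ∈ r.2, e.1 < e.2) :
    ∀ (m : ℕ) (p : List ℕ), canProlong r s m p = true → p.Nodup → (∀ x ∈ p, x < s.1) →
      (∀ e ∈ r.2, e.2 < p.length → (p.getD e.1 0, p.getD e.2 0) ∈ s.2 ∨
        (p.getD e.2 0, p.getD e.1 0) ∈ s.2) →
      ∃ q : List ℕ, q.length = p.length + m ∧ q.Nodup ∧ (∀ x ∈ q, x < s.1) ∧
        ∀ e ∈ r.2, e.2 < q.length → (q.getD e.1 0, q.getD e.2 0) ∈ s.2 ∨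
          (q.getD e.2 0, q.getD e.1 0) ∈ s.2
  | 0, p, _, hnd, hlt, hedge => ⟨p, rfl, hnd, hlt, hedge⟩
  | m + 1, p, h, hnd, hlt, hedge => by
    simp only [canProlong, List.any_eq_true, List.mem_range, Bool.and_eq_true, List.all_eq_true,
      Bool.or_eq_true, bne_iff_ne, Bool.not_eq_true', List.contains_iff_mem,
      ← Bool.not_eq_true] at h
    obtain ⟨x, hx, ⟨hxp, hall⟩, hrec⟩ := h
    obtain ⟨q, hq, hq'⟩ := exists_prolongation hr m (p ++ [x]) hrec
      (by simpa [List.nodup_append] using ⟨hnd, fun a ha hax => hxp (hax ▸ ha)⟩)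
      (by
        intro y hy
        obtain hy | rfl : y ∈ p ∨ y = x := by simpa using hy
        · exact hlt y hy
        · exact hx)
      (by
        intro e he hlen
        have hlt := hr e he
        rw [List.length_append, List.length_singleton] at hlen
        rw [List.getD_append _ _ _ _ (by omega)]
        obtain hep | hep : e.2 < p.length ∨ e.2 = p.length := by omega
        · rw [List.getD_append _ _ _ _ hep]
          exact hedge e he hep
        · have hlast : (p ++ [x]).getD e.2 0 = x := by simp [hep]
          rw [hlast]
          simpa [hep] using hall e he)
    exact ⟨q, by simpa [Nat.add_assoc, Nat.add_comm 1 m] using hq, hq'⟩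

theorem isContained_of_canProlong {r s : EdgeList} (hr : r.IsGrowing)
    (h : canProlong r s r.1 [] = true) : r.graph ⊑ s.graph := by
  obtain ⟨q, hlen, hnd, hlt, hedge⟩ := exists_prolongation (fun e he => (hr.2.1 e he).1) r.1 [] h
    List.nodup_nil (by simp) (by simp)
  rw [List.length_nil, Nat.zero_add] at hlen
  have hget (u : Fin r.1) : q.getD u 0 = q[(u : ℕ)]'(by omega) :=
    List.getD_eq_getElem _ _ _
  let f (u : Fin r.1) : Fin s.1 := ⟨q.getD u 0, by rw [hget]; exact hlt _ (List.getElem_mem _)⟩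
  have hf : Function.Injective f := by
    intro u v huv
    have huv' := congrArg Fin.val huv
    simp only [f, hget] at huv'
    exact Fin.ext (hnd.getElem_inj_iff.mp huv')
  refine ⟨⟨⟨f, fun {u v} huv => ?_⟩, hf⟩⟩
  obtain ⟨hne, h1 | h1⟩ := graph_adj.mp huv
  · exact graph_adj.mpr ⟨hf.ne hne, hedge _ h1 (by omega)⟩
  · exact graph_adj.mpr ⟨hf.ne hne, (hedge _ h1 (by omega)).symm⟩

variable {V : Type*} {G : SimpleGraph V}

theorem addEdge_isContained {r : EdgeList} (f : Copy r.graph G) {u w : Fin r.1}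
    (h : G.Adj (f u) (f w)) : (r.addEdge u w).graph ⊑ G := by
  have key (a b : Fin r.1) (hne : a ≠ b) (hab : ((a : ℕ), (b : ℕ)) ∈ (r.addEdge u w).2) :
      G.Adj (f a) (f b) := by
    obtain hab | hab := List.mem_cons.mp hab
    · obtain ⟨ha, hb⟩ := Prod.mk.inj hab
      rwa [Fin.ext ha, Fin.ext hb]
    · exact f.toHom.map_adj (graph_adj.mpr ⟨hne, .inl hab⟩)
  refine ⟨⟨⟨f, fun {a b} hab => ?_⟩, f.injective⟩⟩
  obtain ⟨hne, hab | hab⟩ := graph_adj.mp hab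
  · exact key a b hne hab
  · exact (key b a hne.symm hab).symm

theorem addLeaf_isContained {r : EdgeList} (hr : ∀ e ∈ r.2, e.1 < e.2 ∧ e.2 < r.1)
    (f : Copy r.graph G) {u : Fin r.1} {v : V} (h : G.Adj (f u) v) (hv : ∀ w, f w ≠ v) :
    (r.addLeaf u).graph ⊑ G := by
  let g : Fin (r.1 + 1) → V := Fin.snoc (α := fun _ => V) f v
  have hg : Function.Injective g :=
    Fin.snoc_injective_of_injective f.injective (by rintro ⟨w, hw⟩; exact hv w hw)
  have key (a b : Fin (r.1 + 1)) (hab : ((a : ℕ), (b : ℕ)) ∈ (r.addLeaf u).2) :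
      G.Adj (g a) (g b) := by
    obtain hab | hab := List.mem_cons.mp hab
    · obtain ⟨ha, hb⟩ := Prod.mk.inj hab
      obtain rfl : a = u.castSucc := Fin.ext ha
      obtain rfl : b = Fin.last r.1 := Fin.ext hb
      simpa [g] using h
    · obtain ⟨hlt, hlt'⟩ := hr _ hab
      obtain ⟨a', rfl⟩ : ∃ c : Fin r.1, c.castSucc = a := ⟨⟨a, hlt.trans hlt'⟩, rfl⟩
      obtain ⟨b', rfl⟩ : ∃ c : Fin r.1, c.castSucc = b := ⟨⟨b, hlt'⟩, rfl⟩
      simp only [g, Fin.snoc_castSucc]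
      refine f.toHom.map_adj (graph_adj.mpr ⟨?_, .inl hab⟩)
      exact fun h => hlt.ne (congrArg (fun c => (c.castSucc : ℕ)) h)
  refine ⟨⟨⟨g, fun {a b} hab => ?_⟩, hg⟩⟩
  obtain ⟨-, hab | hab⟩ := graph_adj.mp hab
  · exact key a b hab
  · exact (key b a hab).symm

theorem IsGrowing.connected {r : EdgeList} (hr : r.IsGrowing) : r.graph.Connected := by
  have hreach : ∀ (n : ℕ) (hn : n < r.1), r.graph.Reachable ⟨0, hr.1⟩ ⟨n, hn⟩ := by
    intro n
    induction n using Nat.strong_induction_on with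
    | _ n ih =>
      intro hn
      obtain rfl | hpos := eq_or_ne n 0
      · rfl
      · obtain ⟨e, he, rfl⟩ := hr.2.2 n hn hpos
        have hlt := (hr.2.1 e he).1
        refine (ih e.1 hlt (hlt.trans hn)).trans (Adj.reachable (graph_adj.mpr ⟨?_, .inl he⟩))
        exact fun h => hlt.ne (congrArg Fin.val h)
  have : Nonempty (Fin r.1) := ⟨⟨0, hr.1⟩⟩
  exact ⟨fun u v => (hreach u u.2).symm.trans (hreach v v.2)⟩

theorem ncard_edgeSet_of_mem_representatives {k : ℕ} (hk : k < 7) {r : EdgeList}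
    (hr : r ∈ representatives k) : r.graph.edgeSet.ncard = k := by
  have h := sum_degree_of_mem_representatives k hk r hr
  rw [sum_degrees_eq_twice_card_edges] at h
  rw [← coe_edgeFinset, Set.ncard_coe_finset]
  omega

/-- A finite connected graph with at least `k` edges contains a representative with `k` edges. -/
theorem exists_representative_isContained [Finite V] (hG : G.Connected) :
    ∀ k < 7, k ≤ G.edgeSet.ncard → ∃ r ∈ representatives k, r.graph ⊑ G
  | 0, _, _ => by
    obtain ⟨v⟩ := hG.nonempty
    refine ⟨(1, []), by simp [representatives], ⟨⟨⟨fun _ => v, fun {a b} hab => ?_⟩, ?_⟩⟩⟩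
    · exact absurd (Subsingleton.elim a b) hab.ne
    · exact fun a b _ => Subsingleton.elim (α := Fin 1) a b
  | k + 1, hk, hcard => by
    obtain ⟨r, hr, ⟨f⟩⟩ := exists_representative_isContained hG k (by omega) (by omega)
    have hgrow := isGrowing_of_mem_representatives k (by omega) r hr
    have : Nonempty (Fin r.1) := ⟨⟨0, hgrow.1⟩⟩
    have hncard := ncard_edgeSet_of_mem_representatives (by omega) hr
    obtain ⟨u, v, huv, hnew⟩ := f.exists_adj_of_ncard_lt hG (by omega)
    by_cases hv : ∃ w, f w = v
    · obtain ⟨w, rfl⟩ := hv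
      have hnadj : ¬ r.graph.Adj u w := hnew w rfl
      clear hnew
      wlog huw : u < w generalizing u w
      · refine this w u huv.symm (fun h => hnadj h.symm) (lt_of_le_of_ne (not_lt.mp huw) ?_)
        rintro rfl
        exact huv.ne rfl
      have hnotin : ((u : ℕ), (w : ℕ)) ∉ r.2 :=
        fun h => hnadj (graph_adj.mpr ⟨huw.ne, .inl h⟩)
      obtain ⟨s, hs, -, hsearch⟩ :=
        (canProlong_addEdge k (by omega) r hr w w.2 u huw).resolve_left hnotin
      exact ⟨s, hs, (isContained_of_canProlong
        (isGrowing_of_mem_representatives _ hk s hs) hsearch).trans (addEdge_isContained f huv)⟩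
    · obtain ⟨s, hs, -, hsearch⟩ := canProlong_addLeaf k (by omega) r hr u u.2
      exact ⟨s, hs, (isContained_of_canProlong
        (isGrowing_of_mem_representatives _ hk s hs) hsearch).trans
        (addLeaf_isContained hgrow.2.1 f huv fun w hw => hv ⟨w, hw⟩)⟩

theorem exists_representative_iso [Finite V] (hG : G.Connected) {k : ℕ} (hk : k < 7)
    (hcard : G.edgeSet.ncard = k) : ∃ r ∈ representatives k, Nonempty (r.graph ≃g G) := by
  obtain ⟨r, hr, ⟨f⟩⟩ := exists_representative_isContained hG k hk hcard.ge
  have : Nonempty (Fin r.1) := ⟨⟨0, (isGrowing_of_mem_representatives k hk r hr).1⟩⟩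
  exact ⟨r, hr, f.nonempty_iso_of_ncard_le hG
    (by rw [hcard, ncard_edgeSet_of_mem_representatives hk hr])⟩

/-- The graphlet described by a representative with 6 edges. -/
def toGraphlet (r : EdgeList) (hr : r ∈ representatives 6) : Graphlet 6 :=
  ⟨⟨r.1, r.graph⟩, (isGrowing_of_mem_representatives 6 (by norm_num) r hr).connected, by
    have hcard := ncard_edgeSet_of_mem_representatives (by norm_num) hr
    have hconn := (isGrowing_of_mem_representatives 6 (by norm_num) r hr).connected
    have : Nontrivial (Fin r.1) := by
      by_contra h
      rw [not_nontrivial_iff_subsingleton] at h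
      have hempty : r.graph.edgeSet = ∅ := by
        rw [edgeSet_eq_empty]
        exact Subsingleton.elim _ _
      simp [hempty] at hcard
    exact fun v => hconn.preconnected.exists_adj_of_nontrivial v,
    ncard_edgeSet_of_mem_representatives (by norm_num) hr⟩

end EdgeList

theorem graphletIso_equivalence (k : ℕ) : Equivalence (@graphletIso k) where
  refl _ := ⟨Iso.refl⟩
  symm := fun ⟨e⟩ => ⟨e.symm⟩
  trans := fun ⟨e⟩ ⟨e'⟩ => ⟨e.trans e'⟩

/-- The number of isomorphism classes of finite connected simple graphs with no
isolated vertices having exactly 6 edges is 30. -/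
theorem graphlet_count_6 :
    Nat.card (Quot (@graphletIso 6)) = 30 := by
  let f (i : Fin (EdgeList.representatives 6).length) : Quot (@graphletIso 6) :=
    Quot.mk _ (EdgeList.toGraphlet _ (List.get_mem (EdgeList.representatives 6) i))
  have hf : Function.Bijective f := by
    constructor
    · intro i j hij
      obtain ⟨e⟩ : graphletIso _ _ :=
        (graphletIso_equivalence 6).eqvGen_iff.mp (Quot.eqvGen_exact hij)
      have hinv := Iso.degreeInvariant_eq (G := EdgeList.graph _) (H := EdgeList.graph _) e
      have hnodup := EdgeList.nodup_degreeInvariant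
      rw [List.nodup_iff_injective_get] at hnodup
      have := @hnodup (i.cast (by simp)) (j.cast (by simp)) (by simpa using hinv)
      exact Fin.ext (by simpa using congrArg Fin.val this)
    · rintro ⟨G⟩
      obtain ⟨r, hr, he⟩ :=
        EdgeList.exists_representative_iso G.2.1 (by norm_num) G.2.2.2
      obtain ⟨i, rfl⟩ := List.get_of_mem hr
      exact ⟨i, Quot.sound he⟩
  rw [← Nat.card_eq_of_bijective f hf, Nat.card_fin]
  rfl
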